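/- (Indistinguishable contaminated instances.) Fix ρ > 0 and ε ∈ (0, 1/2). Define probability distributions on ℝ: 𝒟₁ puts mass ε/(4(1−ε)) at ρ/√ε and mass 1 − ε/(4(1−ε)) at 0; 𝒟₂ puts mass ε/(4(1−ε)) at −ρ/√ε and mass 1 − ε/(4(1−ε)) at 0; 𝒬₁ puts masses 1/2, 1/4, 1/4 at −ρ/√ε, 0, ρ/√ε respectively; 𝒬₂ puts masses 1/4, 1/4, 1/2 at −ρ/√ε, 0, ρ/√ε respectively. Then: (i) (1−ε)𝒟₁ + ε𝒬₁ = (1−ε)𝒟₂ + ε𝒬₂, and this common mixture puts mass ε/2 at each of ±ρ/√ε and mass 1−ε at 0; (ii) 𝒟₁ has mean R₁ = ρ√ε/(4(1−ε)) and 𝒟₂ has mean R₂ = −R₁, so R₁ − R₂ = ρ√ε/(2(1−ε)); (iii) each of 𝒟₁ and 𝒟₂ has variance at most ρ²/2 < ρ². -/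

import Mathlib

open MeasureTheory

/-- The true reward distribution of MRP 1: mass `ε/(4(1−ε))` at `ρ/√ε`, rest at `0`. -/
noncomputable def hardD1 (ρ ε : ℝ) : Measure ℝ :=
  ENNReal.ofReal (ε / (4 * (1 - ε))) • Measure.dirac (ρ / Real.sqrt ε) +
    ENNReal.ofReal (1 - ε / (4 * (1 - ε))) • Measure.dirac 0

/-- The true reward distribution of MRP 2: mass `ε/(4(1−ε))` at `−ρ/√ε`, rest at `0`. -/
noncomputable def hardD2 (ρ ε : ℝ) : Measure ℝ :=
  ENNReal.ofReal (ε / (4 * (1 - ε))) • Measure.dirac (-(ρ / Real.sqrt ε)) +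
    ENNReal.ofReal (1 - ε / (4 * (1 - ε))) • Measure.dirac 0

/-- Adversarial distribution 1: masses `1/2, 1/4, 1/4` at `−ρ/√ε, 0, ρ/√ε`. -/
noncomputable def hardQ1 (ρ ε : ℝ) : Measure ℝ :=
  ENNReal.ofReal (1 / 2) • Measure.dirac (-(ρ / Real.sqrt ε)) +
    ENNReal.ofReal (1 / 4) • Measure.dirac 0 +
    ENNReal.ofReal (1 / 4) • Measure.dirac (ρ / Real.sqrt ε)

/-- Adversarial distribution 2: masses `1/4, 1/4, 1/2` at `−ρ/√ε, 0, ρ/√ε`. -/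
noncomputable def hardQ2 (ρ ε : ℝ) : Measure ℝ :=
  ENNReal.ofReal (1 / 4) • Measure.dirac (-(ρ / Real.sqrt ε)) +
    ENNReal.ofReal (1 / 4) • Measure.dirac 0 +
    ENNReal.ofReal (1 / 2) • Measure.dirac (ρ / Real.sqrt ε)

/-- Huber mixture `(1−ε)𝒫₁ + ε𝒫₂`. -/
noncomputable def huberMix (ε : ℝ) (P₁ P₂ : Measure ℝ) : Measure ℝ :=
  ENNReal.ofReal (1 - ε) • P₁ + ENNReal.ofReal ε • P₂

/-- Integral against a two-point measure with nonnegative real weights. -/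
theorem integral_two_point (f : ℝ → ℝ) {p q : ℝ} (hp : 0 ≤ p) (hq : 0 ≤ q) (x y : ℝ) :
    (∫ t, f t ∂(ENNReal.ofReal p • Measure.dirac x + ENNReal.ofReal q • Measure.dirac y)) =
      p * f x + q * f y := by
  have hint (r z : ℝ) : Integrable f (ENNReal.ofReal r • Measure.dirac z) :=
    (integrable_dirac (by simp)).smul_measure ENNReal.ofReal_ne_top
  rw [integral_add_measure (hint p x) (hint q y), integral_smul_measure, integral_smul_measure,
    integral_dirac, integral_dirac, ENNReal.toReal_ofReal hp, ENNReal.toReal_ofReal hq,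
    smul_eq_mul, smul_eq_mul]

theorem hard_weight_mem_Icc {ε : ℝ} (hε0 : 0 < ε) (hε : ε < 1 / 2) :
    0 ≤ ε / (4 * (1 - ε)) ∧ 0 ≤ 1 - ε / (4 * (1 - ε)) := by
  have h : 0 < 4 * (1 - ε) := by linarith
  refine ⟨by positivity, ?_⟩
  rw [sub_nonneg, div_le_one h]
  linarith

/-- Contaminating the two-point measure at `x` and `0` by masses `1/4, 1/4, 1/2` at `x, 0, y`
gives a measure that is symmetric in `x` and `y`. -/
theorem huberMix_two_point {ε : ℝ} (hε0 : 0 < ε) (hε : ε < 1 / 2) (x y : ℝ) :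
    huberMix ε
        (ENNReal.ofReal (ε / (4 * (1 - ε))) • Measure.dirac x +
          ENNReal.ofReal (1 - ε / (4 * (1 - ε))) • Measure.dirac 0)
        (ENNReal.ofReal (1 / 4) • Measure.dirac x + ENNReal.ofReal (1 / 4) • Measure.dirac 0 +
          ENNReal.ofReal (1 / 2) • Measure.dirac y) =
      ENNReal.ofReal (ε / 2) • Measure.dirac x + ENNReal.ofReal (ε / 2) • Measure.dirac y +
        ENNReal.ofReal (1 - ε) • Measure.dirac (0 : ℝ) := by
  obtain ⟨hp, hq⟩ := hard_weight_mem_Icc hε0 hε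
  have h1 : 0 < 1 - ε := by linarith
  have hx : ENNReal.ofReal (ε / 2) = ENNReal.ofReal (1 - ε) * ENNReal.ofReal (ε / (4 * (1 - ε))) +
      ENNReal.ofReal ε * ENNReal.ofReal (1 / 4) := by
    rw [← ENNReal.ofReal_mul h1.le, ← ENNReal.ofReal_mul hε0.le,
      ← ENNReal.ofReal_add (by positivity) (by positivity)]
    congr 1
    field_simp
    ring
  have h0 : ENNReal.ofReal (1 - ε) =
      ENNReal.ofReal (1 - ε) * ENNReal.ofReal (1 - ε / (4 * (1 - ε))) +
        ENNReal.ofReal ε * ENNReal.ofReal (1 / 4) := by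
    rw [← ENNReal.ofReal_mul h1.le, ← ENNReal.ofReal_mul hε0.le,
      ← ENNReal.ofReal_add (by positivity) (by positivity)]
    congr 1
    field_simp
    ring
  have hy : ENNReal.ofReal (ε / 2) = ENNReal.ofReal ε * ENNReal.ofReal (1 / 2) := by
    rw [← ENNReal.ofReal_mul hε0.le]
    congr 1
    ring
  calc
    _ = (ENNReal.ofReal (1 - ε) * ENNReal.ofReal (ε / (4 * (1 - ε))) +
          ENNReal.ofReal ε * ENNReal.ofReal (1 / 4)) • Measure.dirac x +
        (ENNReal.ofReal ε * ENNReal.ofReal (1 / 2)) • Measure.dirac y +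
        (ENNReal.ofReal (1 - ε) * ENNReal.ofReal (1 - ε / (4 * (1 - ε))) +
          ENNReal.ofReal ε * ENNReal.ofReal (1 / 4)) • Measure.dirac (0 : ℝ) := by
      simp only [huberMix, smul_add, smul_smul, add_smul]
      abel
    _ = _ := by rw [← hx, ← hy, ← h0]

/-- The variance of a two-point distribution is at most its second moment. -/
theorem two_point_variance_le (p x : ℝ) :
    p * (x - p * x) ^ 2 + (1 - p) * (0 - p * x) ^ 2 ≤ p * x ^ 2 := by
  nlinarith [sq_nonneg (p * x)]

/-- **Indistinguishable contaminated instances.**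
For `ρ > 0` and `ε ∈ (0,1/2)`: (i) the two contaminated mixtures coincide and put
mass `ε/2` at each of `±ρ/√ε` and `1−ε` at `0`; (ii) `𝒟₁` has mean
`R₁ = ρ√ε/(4(1−ε))` and `𝒟₂` has mean `R₂ = −R₁`, so `R₁ − R₂ = ρ√ε/(2(1−ε))`;
(iii) each of `𝒟₁, 𝒟₂` has variance at most `ρ²/2 < ρ²`. -/
theorem indistinguishable_contaminated_instances
    (ρ ε : ℝ) (hρ : 0 < ρ) (hε0 : 0 < ε) (hε : ε < 1 / 2) :
    (huberMix ε (hardD1 ρ ε) (hardQ1 ρ ε) = huberMix ε (hardD2 ρ ε) (hardQ2 ρ ε) ∧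
      huberMix ε (hardD1 ρ ε) (hardQ1 ρ ε) =
        ENNReal.ofReal (ε / 2) • Measure.dirac (ρ / Real.sqrt ε) +
          ENNReal.ofReal (ε / 2) • Measure.dirac (-(ρ / Real.sqrt ε)) +
          ENNReal.ofReal (1 - ε) • Measure.dirac (0 : ℝ)) ∧
    ((∫ x, x ∂hardD1 ρ ε) = ρ * Real.sqrt ε / (4 * (1 - ε)) ∧
      (∫ x, x ∂hardD2 ρ ε) = -(ρ * Real.sqrt ε / (4 * (1 - ε))) ∧
      ρ * Real.sqrt ε / (4 * (1 - ε)) - (-(ρ * Real.sqrt ε / (4 * (1 - ε)))) =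
        ρ * Real.sqrt ε / (2 * (1 - ε))) ∧
    ((∫ x, (x - ρ * Real.sqrt ε / (4 * (1 - ε))) ^ 2 ∂hardD1 ρ ε) ≤ ρ ^ 2 / 2 ∧
      (∫ x, (x - -(ρ * Real.sqrt ε / (4 * (1 - ε)))) ^ 2 ∂hardD2 ρ ε) ≤ ρ ^ 2 / 2 ∧
      ρ ^ 2 / 2 < ρ ^ 2) := by
  obtain ⟨hp, hq⟩ := hard_weight_mem_Icc hε0 hε
  have h1 : 0 < 1 - ε := by linarith
  have hs : 0 < Real.sqrt ε := Real.sqrt_pos.mpr hε0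
  have hmean : ρ * Real.sqrt ε / (4 * (1 - ε)) = ε / (4 * (1 - ε)) * (ρ / Real.sqrt ε) := by
    have hsq := Real.sq_sqrt hε0.le
    field_simp
    exact hsq
  have hmoment : ε / (4 * (1 - ε)) * (ρ / Real.sqrt ε) ^ 2 ≤ ρ ^ 2 / 2 := by
    rw [div_pow, Real.sq_sqrt hε0.le]
    have : ε / (4 * (1 - ε)) * (ρ ^ 2 / ε) = ρ ^ 2 / (4 * (1 - ε)) := by field_simp
    rw [this]
    exact div_le_div_of_nonneg_left (by positivity) two_pos (by linarith)
  have hmix1 : huberMix ε (hardD1 ρ ε) (hardQ1 ρ ε) =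
      ENNReal.ofReal (ε / 2) • Measure.dirac (ρ / Real.sqrt ε) +
        ENNReal.ofReal (ε / 2) • Measure.dirac (-(ρ / Real.sqrt ε)) +
        ENNReal.ofReal (1 - ε) • Measure.dirac (0 : ℝ) := by
    rw [← huberMix_two_point hε0 hε, hardD1, hardQ1]
    congr 1
    abel
  have hmix2 : huberMix ε (hardD2 ρ ε) (hardQ2 ρ ε) =
      ENNReal.ofReal (ε / 2) • Measure.dirac (ρ / Real.sqrt ε) +
        ENNReal.ofReal (ε / 2) • Measure.dirac (-(ρ / Real.sqrt ε)) +
        ENNReal.ofReal (1 - ε) • Measure.dirac (0 : ℝ) := by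
    rw [hardD2, hardQ2, huberMix_two_point hε0 hε]
    abel
  refine ⟨⟨hmix1.trans hmix2.symm, hmix1⟩, ⟨?_, ?_, ?_⟩, ?_, ?_, ?_⟩
  · rw [hardD1, integral_two_point (fun x => x) hp hq, hmean]
    ring
  · rw [hardD2, integral_two_point (fun x => x) hp hq, hmean]
    ring
  · field_simp
    ring
  · rw [hardD1, integral_two_point _ hp hq, hmean]
    exact (two_point_variance_le _ _).trans hmoment
  · rw [hardD2, integral_two_point _ hp hq, hmean, ← mul_neg]
    refine (two_point_variance_le _ _).trans ?_
    rwa [neg_sq]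
  · exact half_lt_self (by positivity)
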